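/- Let n ≥ 3 and let G be an invertible n×n real matrix whose rows g₁,…,gₙ have Gram matrix Γ_{Dₙ} (diagonal entries 2, entries (1,2),(2,1) equal to 0, all other off-diagonal entries 1). For every subset S ⊆ {3,…,n} with |S| = i, writing x_S = Σ_{j∈S} g_j: (a) the corner x_S + g₁ ∈ C¹ satisfies |T_f(x_S + g₁) ∩ C⁰| = 1 + (n − 2 − i); and (b) the corner x_S + g₂ + g₁ ∈ C¹ satisfies |T_f(x_S + g₂ + g₁) ∩ C⁰| = 1 + 2(n − 2 − i) + C(n − 2 − i, 2), where C(·,·) is the binomial coefficient. (Summing these cardinalities over the C(n−2,i) subsets of each size i gives the exponential piece count of the decision boundary function of Dₙ.) -/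

import Mathlib

open Matrix Finset

/-- Euclidean norm of a vector in `ℝⁿ`. -/
noncomputable def nrm {n : ℕ} (v : Fin n → ℝ) : ℝ := Real.sqrt (∑ i, v i ^ 2)

/-- The lattice generated by the rows of `G`. -/
def latticePt {n : ℕ} (G : Matrix (Fin n) (Fin n) ℝ) (x : Fin n → ℝ) : Prop :=
  ∃ z : Fin n → ℤ, x = (fun i => (z i : ℝ)) ᵥ* G

/-- The Voronoi region of `x` in the lattice generated by `G`. -/
def Vor {n : ℕ} (G : Matrix (Fin n) (Fin n) ℝ) (x : Fin n → ℝ) : Set (Fin n → ℝ) :=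
  {y | ∀ lam : Fin n → ℝ, latticePt G lam → nrm (y - x) ≤ nrm (y - lam)}

/-- `x'` shares an `(n−1)`-dimensional Voronoi facet with `x`. -/
def sharesFacet {n : ℕ} (G : Matrix (Fin n) (Fin n) ℝ) (x x' : Fin n → ℝ) : Prop :=
  Module.finrank ℝ (affineSpan ℝ (Vor G x ∩ Vor G x')).direction = n - 1

/-- The corner set `C^b = {zG : z ∈ {0,1}ⁿ, z₁ = b}`. -/
def cornerSet {n : ℕ} [NeZero n] (G : Matrix (Fin n) (Fin n) ℝ) (b : ℝ) :
    Set (Fin n → ℝ) :=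
  {x | ∃ z : Fin n → ℝ, (∀ i, z i = 0 ∨ z i = 1) ∧ z 0 = b ∧ x = z ᵥ* G}

/-- The `Dₙ` Gram matrix: diagonal entries `2`, entries `(1,2)` and `(2,1)` equal to `0`
(in 1-based indexing), all other off-diagonal entries `1`. -/
def gramD (n : ℕ) : Matrix (Fin n) (Fin n) ℝ :=
  Matrix.of fun i j =>
    if i = j then 2
    else if ((i : ℕ) = 0 ∧ (j : ℕ) = 1) ∨ ((i : ℕ) = 1 ∧ (j : ℕ) = 0) then 0 else 1

section Voronoi

variable {n : ℕ} {G : Matrix (Fin n) (Fin n) ℝ}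

lemma nrm_le_nrm_iff (a b : Fin n → ℝ) : nrm a ≤ nrm b ↔ a ⬝ᵥ a ≤ b ⬝ᵥ b := by
  have h (v : Fin n → ℝ) : ∑ i, v i ^ 2 = v ⬝ᵥ v := by simp [dotProduct, sq]
  rw [nrm, nrm, Real.sqrt_le_sqrt_iff (Finset.sum_nonneg fun i _ => sq_nonneg _), h, h]

lemma dotProduct_self_sub (a b : Fin n → ℝ) :
    (a - b) ⬝ᵥ (a - b) = a ⬝ᵥ a - 2 * (a ⬝ᵥ b) + b ⬝ᵥ b := by
  simp only [sub_dotProduct, dotProduct_sub, dotProduct_comm b a]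
  ring

lemma dotProduct_self_nonneg_real (a : Fin n → ℝ) : 0 ≤ a ⬝ᵥ a :=
  Finset.sum_nonneg fun i _ => mul_self_nonneg (a i)

lemma latticePt.sub {x y : Fin n → ℝ} (hx : latticePt G x) (hy : latticePt G y) :
    latticePt G (x - y) := by
  obtain ⟨z, rfl⟩ := hx
  obtain ⟨w, rfl⟩ := hy
  refine ⟨z - w, ?_⟩
  rw [← sub_vecMul]
  congr 1
  ext i
  simp

lemma latticePt.add {x y : Fin n → ℝ} (hx : latticePt G x) (hy : latticePt G y) :
    latticePt G (x + y) := by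
  obtain ⟨z, rfl⟩ := hx
  obtain ⟨w, rfl⟩ := hy
  refine ⟨z + w, ?_⟩
  rw [← add_vecMul]
  congr 1
  ext i
  simp

/-- The Voronoi region of a lattice point, cut out by one half-space per lattice vector. -/
lemma mem_Vor_iff {x : Fin n → ℝ} (hx : latticePt G x) (y : Fin n → ℝ) :
    y ∈ Vor G x ↔ ∀ w, latticePt G w → 2 * ((y - x) ⬝ᵥ w) ≤ w ⬝ᵥ w := by
  have key (w : Fin n → ℝ) :
      nrm (y - x) ≤ nrm (y - x - w) ↔ 2 * ((y - x) ⬝ᵥ w) ≤ w ⬝ᵥ w := by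
    rw [nrm_le_nrm_iff, dotProduct_self_sub (y - x) w]
    constructor <;> intro h <;> linarith
  constructor
  · intro h w hw
    rw [← key, sub_sub]
    exact h _ (hx.add hw)
  · intro h lam hlam
    have := (key (lam - x)).2 (h _ (hlam.sub hx))
    rwa [sub_sub_sub_cancel_right] at this

/-- A point of `Vor G x ∩ Vor G (x + v)` lies on the bisector of `x` and `x + v`. -/
lemma two_mul_dotProduct_of_mem_Vor_inter {x v y : Fin n → ℝ} (hx : latticePt G x)
    (hv : latticePt G v) (hy : y ∈ Vor G x ∩ Vor G (x + v)) :
    2 * ((y - x) ⬝ᵥ v) = v ⬝ᵥ v := by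
  refine le_antisymm ((mem_Vor_iff hx y).1 hy.1 v hv) ?_
  have h := hy.2 x hx
  rw [← sub_sub, nrm_le_nrm_iff, dotProduct_self_sub (y - x) v] at h
  linarith

lemma mem_Vor_add {x v y : Fin n → ℝ} (hy : y ∈ Vor G x)
    (h : 2 * ((y - x) ⬝ᵥ v) = v ⬝ᵥ v) : y ∈ Vor G (x + v) := by
  intro lam hlam
  refine le_trans ?_ (hy lam hlam)
  rw [← sub_sub, nrm_le_nrm_iff, dotProduct_self_sub (y - x) v]
  linarith

lemma direction_affineSpan_le_ker {V : Type*} [AddCommGroup V] [Module ℝ V] {s : Set V}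
    (f : V →ₗ[ℝ] ℝ) (c : ℝ) (h : ∀ y ∈ s, f y = c) :
    (affineSpan ℝ s).direction ≤ LinearMap.ker f := by
  rw [direction_affineSpan, vectorSpan_def, Submodule.span_le]
  rintro _ ⟨a, ha, b, hb, rfl⟩
  simp [h a ha, h b hb]

lemma finrank_ker_dotProduct {v : Fin n → ℝ} (hv : v ⬝ᵥ v ≠ 0) :
    Module.finrank ℝ (LinearMap.ker (dotProductBilin ℝ ℝ v)) = n - 1 := by
  have hne : dotProductBilin ℝ ℝ v ≠ 0 := fun h => hv (by
    simpa using congrArg (fun f => f v) h)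
  have := Module.Dual.finrank_ker_add_one_of_ne_zero (f := dotProductBilin ℝ ℝ v) hne
  simp only [Module.finrank_fintype_fun_eq_card, Fintype.card_fin] at this
  omega

/-- If all nonzero lattice vectors have squared norm at least `2`, then every lattice vector of
squared norm `2` is facet-defining. -/
lemma sharesFacet_of_dotProduct_self_eq_two
    (hmin : ∀ w, latticePt G w → w ≠ 0 → 2 ≤ w ⬝ᵥ w) {x v : Fin n → ℝ}
    (hx : latticePt G x) (hv : latticePt G v) (hv2 : v ⬝ᵥ v = 2) :
    sharesFacet G x (x + v) := by
  have hbis {y : Fin n → ℝ} (hy : y ∈ Vor G x ∩ Vor G (x + v)) : (v ⬝ᵥ y) = v ⬝ᵥ x + 1 := by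
    have := two_mul_dotProduct_of_mem_Vor_inter hx hv hy
    rw [sub_dotProduct, hv2, dotProduct_comm y, dotProduct_comm x] at this
    linarith
  have hnear {u : Fin n → ℝ} (huv : v ⬝ᵥ u = 0) (hu : u ⬝ᵥ u ≤ 1 / 16) :
      x + ((1 / 2 : ℝ) • v + u) ∈ Vor G x ∩ Vor G (x + v) := by
    have hmem : x + ((1 / 2 : ℝ) • v + u) ∈ Vor G x := by
      rw [mem_Vor_iff hx]
      intro w hw
      rw [add_sub_cancel_left, add_dotProduct, smul_dotProduct, smul_eq_mul]
      by_cases hw0 : w = 0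
      · simp [hw0]
      by_cases hwv : w = v
      · rw [hwv, dotProduct_comm u, huv]
        linarith
      have h1 := hmin w hw hw0
      have h2 := hmin (w - v) (hw.sub hv) (sub_ne_zero.2 hwv)
      rw [dotProduct_self_sub, dotProduct_comm w v] at h2
      have h3 := dotProduct_self_nonneg_real (w - (4 : ℝ) • u)
      rw [dotProduct_self_sub, dotProduct_smul, smul_dotProduct, dotProduct_smul,
        dotProduct_comm w u] at h3
      simp only [smul_eq_mul] at h3
      linarith
    refine ⟨hmem, mem_Vor_add hmem ?_⟩
    rw [add_sub_cancel_left, add_dotProduct, smul_dotProduct, dotProduct_comm u, huv, smul_eq_mul]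
    ring
  have hdir : (affineSpan ℝ (Vor G x ∩ Vor G (x + v))).direction =
      LinearMap.ker (dotProductBilin ℝ ℝ v) := by
    refine le_antisymm (direction_affineSpan_le_ker _ (v ⬝ᵥ x + 1) fun y hy => hbis hy) ?_
    intro u hu
    replace hu : v ⬝ᵥ u = 0 := hu
    have hu0 := dotProduct_self_nonneg_real u
    set ε : ℝ := 1 / (4 * (1 + u ⬝ᵥ u)) with hε
    have hεpos : 0 < ε := by positivity
    have hsmall : (ε • u) ⬝ᵥ (ε • u) ≤ 1 / 16 := by
      rw [smul_dotProduct, dotProduct_smul, smul_eq_mul, smul_eq_mul, hε]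
      rw [show 1 / (4 * (1 + u ⬝ᵥ u)) * (1 / (4 * (1 + u ⬝ᵥ u)) * u ⬝ᵥ u) =
        (1 / 16) * (u ⬝ᵥ u / (1 + u ⬝ᵥ u) ^ 2) by field_simp; ring]
      have : u ⬝ᵥ u / (1 + u ⬝ᵥ u) ^ 2 ≤ 1 := by
        rw [div_le_one (by positivity)]
        nlinarith
      linarith
    have hA := hnear (u := ε • u) (by rw [dotProduct_smul, hu, smul_zero]) hsmall
    have hB := hnear (u := 0) (by simp) (by simp)
    have hmem := vsub_mem_vectorSpan ℝ hA hB
    rw [direction_affineSpan]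
    have heq : u = ε⁻¹ • ((x + ((1 / 2 : ℝ) • v + ε • u)) -ᵥ
        (x + ((1 / 2 : ℝ) • v + (0 : Fin n → ℝ)))) := by
      rw [vsub_eq_sub, add_zero, add_sub_add_left_eq_sub, add_sub_cancel_left,
        inv_smul_smul₀ hεpos.ne']
    rw [heq]
    exact Submodule.smul_mem _ _ hmem
  rw [sharesFacet, hdir, finrank_ker_dotProduct (by rw [hv2]; norm_num)]

/-- A lattice vector `v` of squared norm greater than `2` is not facet-defining as soon as some
lattice vector `w` of squared norm `2` satisfies `2 ≤ w ⬝ᵥ v`. -/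
lemma not_sharesFacet_of_two_le_dotProduct (hn : 2 ≤ n) {x v w : Fin n → ℝ}
    (hx : latticePt G x) (hv : latticePt G v) (hw : latticePt G w)
    (hv2 : 2 < v ⬝ᵥ v) (hw2 : w ⬝ᵥ w = 2) (hwv : 2 ≤ w ⬝ᵥ v) :
    ¬ sharesFacet G x (x + v) := by
  intro hS
  rw [sharesFacet] at hS
  have hsplit {y : Fin n → ℝ} (hy : y ∈ Vor G x ∩ Vor G (x + v)) :
      2 * (w ⬝ᵥ (y - x)) ≤ 2 ∧ w ⬝ᵥ v ≤ w ⬝ᵥ (y - x) + 1 := by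
    have h0 := two_mul_dotProduct_of_mem_Vor_inter hx hv hy
    have h1 := (mem_Vor_iff hx y).1 hy.1 w hw
    have h2 := (mem_Vor_iff hx y).1 hy.1 (v - w) (hv.sub hw)
    rw [dotProduct_self_sub, dotProduct_sub, hw2, dotProduct_comm v w] at h2
    rw [hw2] at h1
    rw [dotProduct_comm w (y - x)]
    constructor <;> linarith
  have hvle := direction_affineSpan_le_ker (s := Vor G x ∩ Vor G (x + v))
    (dotProductBilin ℝ ℝ v) (v ⬝ᵥ x + v ⬝ᵥ v / 2) fun y hy => by
      have := two_mul_dotProduct_of_mem_Vor_inter hx hv hy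
      rw [sub_dotProduct, dotProduct_comm y, dotProduct_comm x] at this
      change v ⬝ᵥ y = _
      linarith
  have hwle := direction_affineSpan_le_ker (s := Vor G x ∩ Vor G (x + v))
    (dotProductBilin ℝ ℝ w) (w ⬝ᵥ x + 1) fun y hy => by
      have := hsplit hy
      rw [dotProduct_sub] at this
      change w ⬝ᵥ y = _
      linarith
  rcases hwv.eq_or_lt with heq | hlt
  · set u : Fin n → ℝ := w - (2 / (v ⬝ᵥ v)) • v with hu
    have hv0 : v ⬝ᵥ v ≠ 0 := by linarith
    have huv : u ∈ LinearMap.ker (dotProductBilin ℝ ℝ v) := by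
      change v ⬝ᵥ u = 0
      rw [hu, dotProduct_sub, dotProduct_smul, dotProduct_comm v w, ← heq, smul_eq_mul]
      field_simp
      ring
    have huw : u ∉ LinearMap.ker (dotProductBilin ℝ ℝ w) := by
      change ¬ w ⬝ᵥ u = 0
      rw [hu, dotProduct_sub, dotProduct_smul, ← heq, hw2, smul_eq_mul]
      intro h
      field_simp at h
      linarith
    have hlt : (affineSpan ℝ (Vor G x ∩ Vor G (x + v))).direction <
        LinearMap.ker (dotProductBilin ℝ ℝ v) :=
      lt_of_le_of_ne hvle fun h => huw (hwle (h ▸ huv))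
    have := Submodule.finrank_lt_finrank_of_lt hlt
    rw [hS, finrank_ker_dotProduct hv0] at this
    exact this.false
  · have hempty : Vor G x ∩ Vor G (x + v) = ∅ := by
      refine Set.eq_empty_of_forall_notMem fun y hy => ?_
      have := hsplit hy
      linarith
    rw [hempty, AffineSubspace.span_empty, AffineSubspace.direction_bot, finrank_bot] at hS
    omega

end Voronoi

section DnLattice

/-- The lattice point with integer coordinates `z` in the basis formed by the rows of `G`. -/
def intComb {n : ℕ} (G : Matrix (Fin n) (Fin n) ℝ) (z : Fin n → ℤ) : Fin n → ℝ :=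
  (fun i => (z i : ℝ)) ᵥ* G

lemma latticePt_intComb {n : ℕ} (G : Matrix (Fin n) (Fin n) ℝ) (z : Fin n → ℤ) :
    latticePt G (intComb G z) := ⟨z, rfl⟩

lemma intComb_sub {n : ℕ} (G : Matrix (Fin n) (Fin n) ℝ) (z w : Fin n → ℤ) :
    intComb G (z - w) = intComb G z - intComb G w := by
  rw [intComb, intComb, intComb, ← sub_vecMul]
  congr 1
  ext i
  simp

lemma intComb_injective {n : ℕ} {G : Matrix (Fin n) (Fin n) ℝ} (hG : IsUnit G.det) :
    Function.Injective (intComb G) := by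
  intro z w h
  have := vecMul_injective_of_isUnit ((isUnit_iff_isUnit_det G).2 hG) h
  ext i
  exact_mod_cast congrFun this i

variable {m : ℕ} {G : Matrix (Fin (m + 2)) (Fin (m + 2)) ℝ}

lemma gramD_eq (i j : Fin (m + 2)) : gramD (m + 2) i j =
    1 + (if i = j then 1 else 0) - (if i = 0 then 1 else 0) * (if j = 1 then 1 else 0) -
      (if i = 1 then 1 else 0) * (if j = 0 then 1 else 0) := by
  have h01 : (0 : Fin (m + 2)) ≠ 1 := by simp
  have h0 (k : Fin (m + 2)) : (k : ℕ) = 0 ↔ k = 0 := Fin.val_eq_zero_iff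
  have h1 (k : Fin (m + 2)) : (k : ℕ) = 1 ↔ k = 1 := by
    rw [Fin.ext_iff, Fin.val_one]
  simp only [gramD, Matrix.of_apply, h0, h1]
  split_ifs <;> grind

/-- The `Dₙ` bilinear form on integer coordinate vectors. -/
def formD (z w : Fin (m + 2) → ℤ) : ℤ :=
  (∑ i, z i) * (∑ i, w i) + z ⬝ᵥ w - z 0 * w 1 - z 1 * w 0

lemma dotProduct_intComb (hGram : G * Gᵀ = gramD (m + 2)) (z w : Fin (m + 2) → ℤ) :
    intComb G z ⬝ᵥ intComb G w = (formD z w : ℝ) := by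
  have h : intComb G z ⬝ᵥ intComb G w =
      (fun i => (z i : ℝ)) ⬝ᵥ gramD (m + 2) *ᵥ fun i => (w i : ℝ) := by
    rw [← hGram, ← mulVec_mulVec, dotProduct_mulVec, mulVec_transpose]
    rfl
  have hmul (i : Fin (m + 2)) : (gramD (m + 2) *ᵥ fun i => (w i : ℝ)) i =
      ∑ j, (w j : ℝ) + w i - (if i = 0 then (w 1 : ℝ) else 0) -
        (if i = 1 then (w 0 : ℝ) else 0) := by
    simp [mulVec, dotProduct, gramD_eq, sub_mul, add_mul, Finset.sum_add_distrib,
      Finset.sum_sub_distrib]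
  rw [h, formD]
  simp only [dotProduct, hmul]
  simp [mul_sub, mul_add, Finset.sum_add_distrib, Finset.sum_sub_distrib, Finset.sum_mul]

/-- The coordinates of a lattice point in the orthonormal frame in which the `Dₙ` basis reads
`e₀ + e₁, e₀ - e₁, e₀ + e₂, e₀ + e₃, …`. -/
def frameCoord (z : Fin (m + 2) → ℤ) : Fin (m + 2) → ℤ :=
  Fin.cons (∑ i, z i) (Fin.cons (z 0 - z 1) fun j => z j.succ.succ)

lemma frameCoord_dotProduct (z w : Fin (m + 2) → ℤ) :
    frameCoord z ⬝ᵥ frameCoord w = formD z w := by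
  simp only [formD, dotProduct, frameCoord, Fin.sum_univ_succ, Fin.cons_zero, Fin.cons_succ,
    Fin.succ_zero_eq_one]
  ring

lemma exists_frameCoord_eq {c : Fin (m + 2) → ℤ} (hc : Even (∑ i, c i)) :
    ∃ z, frameCoord z = c := by
  obtain ⟨k, hk⟩ := hc
  refine ⟨Fin.cons (c 0 + c 1 - k) (Fin.cons (c 0 - k) fun j => c j.succ.succ), ?_⟩
  simp only [Fin.sum_univ_succ, Fin.succ_zero_eq_one] at hk
  ext i
  refine Fin.cases ?_ (fun i => Fin.cases ?_ (fun i => ?_) i) i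
  · simp only [frameCoord, Fin.sum_univ_succ, Fin.cons_zero, Fin.cons_succ]
    linarith
  · change c 0 + c 1 - k - (c 0 - k) = c 1
    ring
  · rfl

lemma even_formD_self (z : Fin (m + 2) → ℤ) : Even (formD z z) := by
  have hsq (a : ℤ) : Even (a * a + a) := by
    rw [← mul_add_one]; exact Int.even_mul_succ_self a
  have h : Even (∑ i, (z i * z i + z i)) := Finset.even_sum _ fun i _ => hsq (z i)
  rw [Finset.sum_add_distrib] at h
  have h1 := hsq (∑ i, z i)
  rw [formD, dotProduct]
  grind

lemma two_le_dotProduct_self (hGram : G * Gᵀ = gramD (m + 2)) {w : Fin (m + 2) → ℝ}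
    (hw : latticePt G w) (hw0 : w ≠ 0) : 2 ≤ w ⬝ᵥ w := by
  obtain ⟨z, rfl⟩ := hw
  change intComb G z ≠ 0 at hw0
  change 2 ≤ intComb G z ⬝ᵥ intComb G z
  have hpos : 0 < intComb G z ⬝ᵥ intComb G z :=
    lt_of_le_of_ne (dotProduct_self_nonneg_real _) fun h => hw0 (dotProduct_self_eq_zero.1 h.symm)
  rw [dotProduct_intComb hGram] at hpos ⊢
  have h0 : 0 < formD z z := by exact_mod_cast hpos
  obtain ⟨k, hk⟩ := even_formD_self z
  have : 2 ≤ formD z z := by omega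
  exact_mod_cast this

lemma exists_two_le_abs_add_abs {ι : Type*} [Fintype ι] [Nontrivial ι] {c : ι → ℤ}
    (hc : 2 ≤ c ⬝ᵥ c) : ∃ k l, k ≠ l ∧ 2 ≤ |c k| + |c l| := by
  classical
  by_contra! h
  obtain ⟨k, hk⟩ : ∃ k, c k ≠ 0 := by
    by_contra! h0
    have : c ⬝ᵥ c = 0 := Finset.sum_eq_zero fun i _ => by simp [h0 i]
    omega
  have hk1 := Int.one_le_abs hk
  have hzero (l : ι) (hl : l ≠ k) : c l = 0 := by
    have := h k l hl.symm
    exact abs_eq_zero.1 (le_antisymm (by omega) (abs_nonneg _))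
  obtain ⟨l, hl⟩ := exists_ne k
  have hsum : c ⬝ᵥ c = c k * c k :=
    Finset.sum_eq_single k (fun l _ hl => by simp [hzero l hl]) (by simp)
  have habs : |c k| = 1 := by
    have := h k l hl.symm
    have := abs_nonneg (c l)
    omega
  rw [hsum, ← abs_mul_abs_self, habs] at hc
  norm_num at hc

/-- Every nonzero vector of `Dₙ` has inner product at least `2` with some root. -/
lemma exists_root_two_le_formD {z : Fin (m + 2) → ℤ} (hz : 2 ≤ formD z z) :
    ∃ w, formD w w = 2 ∧ 2 ≤ formD w z := by
  rw [← frameCoord_dotProduct] at hz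
  obtain ⟨k, l, hkl, h⟩ := exists_two_le_abs_add_abs hz
  have hsign (a : ℤ) : ∃ s : ℤ, (s = 1 ∨ s = -1) ∧ s * a = |a| := by
    rcases abs_choice a with h | h
    · exact ⟨1, by simp, by rw [h, one_mul]⟩
    · exact ⟨-1, by simp, by rw [h, neg_one_mul]⟩
  obtain ⟨s, hs, hsk⟩ := hsign (frameCoord z k)
  obtain ⟨t, ht, htl⟩ := hsign (frameCoord z l)
  obtain ⟨w, hw⟩ := exists_frameCoord_eq (c := Pi.single k s + Pi.single l t) (by
    simp only [Pi.add_apply, Finset.sum_add_distrib, Finset.sum_pi_single', Finset.mem_univ,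
      if_true]
    rcases hs with rfl | rfl <;> rcases ht with rfl | rfl <;> decide)
  refine ⟨w, ?_, ?_⟩
  · rw [← frameCoord_dotProduct, hw]
    simp only [add_dotProduct, single_dotProduct, Pi.add_apply, Pi.single_eq_same,
      Pi.single_eq_of_ne hkl, Pi.single_eq_of_ne hkl.symm]
    rcases hs with rfl | rfl <;> rcases ht with rfl | rfl <;> norm_num
  · rw [← frameCoord_dotProduct, hw, add_dotProduct, single_dotProduct, single_dotProduct, hsk, htl]
    exact h

/-- The facet-defining vectors of `Dₙ` are exactly its roots. -/
theorem sharesFacet_intComb_iff (hG : IsUnit G.det) (hGram : G * Gᵀ = gramD (m + 2))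
    {z z' : Fin (m + 2) → ℤ} (hne : z' ≠ z) :
    sharesFacet G (intComb G z) (intComb G z') ↔ formD (z' - z) (z' - z) = 2 := by
  have hx := latticePt_intComb G z
  have hv := latticePt_intComb G (z' - z)
  rw [← add_sub_cancel (intComb G z) (intComb G z'), ← intComb_sub]
  constructor
  · intro hS
    by_contra hne2
    have hv0 : intComb G (z' - z) ≠ 0 := by
      rw [intComb_sub, sub_ne_zero]
      exact (intComb_injective hG).ne hne
    have h2 := two_le_dotProduct_self hGram hv hv0
    rw [dotProduct_intComb hGram] at h2
    have h2' : 2 ≤ formD (z' - z) (z' - z) := by exact_mod_cast h2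
    obtain ⟨w, hw, hwv⟩ := exists_root_two_le_formD h2'
    refine not_sharesFacet_of_two_le_dotProduct (by omega) hx hv (latticePt_intComb G w)
      ?_ ?_ ?_ hS <;> rw [dotProduct_intComb hGram]
    · exact_mod_cast lt_of_le_of_ne h2' (Ne.symm hne2)
    · exact_mod_cast hw
    · exact_mod_cast hwv
  · intro h
    refine sharesFacet_of_dotProduct_self_eq_two
      (fun w hw hw0 => two_le_dotProduct_self hGram hw hw0) hx hv ?_
    rw [dotProduct_intComb hGram, h]
    norm_num

end DnLattice

section Counting

variable {m : ℕ} {G : Matrix (Fin (m + 2)) (Fin (m + 2)) ℝ}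

/-- The `0/1` coordinate vector of a set of basis indices. -/
def indVec {n : ℕ} (T : Finset (Fin n)) : Fin n → ℤ := fun j => if j ∈ T then 1 else 0

lemma indVec_injective {n : ℕ} : Function.Injective (indVec (n := n)) := by
  intro T U h
  ext j
  have := congrFun h j
  simp only [indVec] at this
  grind

lemma intComb_indVec {n : ℕ} (G : Matrix (Fin n) (Fin n) ℝ) (T : Finset (Fin n)) :
    intComb G (indVec T) = ∑ j ∈ T, G j := by
  ext k
  simp only [intComb, indVec, vecMul, dotProduct, Int.cast_ite, Int.cast_one, Int.cast_zero,
    ite_mul, one_mul, zero_mul, Finset.sum_ite_mem, Finset.univ_inter]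
  exact (Finset.sum_apply k T fun j => G j).symm

lemma mem_cornerSet_zero_iff {n : ℕ} [NeZero n] {G : Matrix (Fin n) (Fin n) ℝ}
    {x : Fin n → ℝ} : x ∈ cornerSet G 0 ↔ ∃ T, 0 ∉ T ∧ intComb G (indVec T) = x := by
  constructor
  · rintro ⟨z, hz, hz0, rfl⟩
    refine ⟨Finset.univ.filter fun j => z j = 1, by simp [hz0], ?_⟩
    rw [intComb]
    congr 1
    ext j
    rcases hz j with h | h <;> simp [indVec, h]
  · rintro ⟨T, hT, rfl⟩
    refine ⟨fun j => (indVec T j : ℝ), fun j => ?_, by simp [indVec, hT], rfl⟩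
    by_cases h : j ∈ T <;> simp [indVec, h]

/-- The facet-neighbors of the corner `X` in `C⁰`, when they are described by the sets `S ∪ U`
with `U` ranging over a family `P` of sets disjoint from `S`. -/
lemma ncard_facetNeighbors (hG : IsUnit G.det) (hGram : G * Gᵀ = gramD (m + 2))
    {S X : Finset (Fin (m + 2))} (hX : 0 ∈ X) {P : Finset (Finset (Fin (m + 2)))}
    (hdisj : ∀ U ∈ P, Disjoint S U)
    (hP : ∀ T, 0 ∉ T ∧ formD (indVec T - indVec X) (indVec T - indVec X) = 2 ↔
      ∃ U ∈ P, S ∪ U = T) :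
    Set.ncard {x' | x' ∈ cornerSet G 0 ∧ sharesFacet G (intComb G (indVec X)) x'} = P.card := by
  have hset : {x' | x' ∈ cornerSet G 0 ∧ sharesFacet G (intComb G (indVec X)) x'} =
      (fun U => intComb G (indVec (S ∪ U))) '' (P : Set (Finset (Fin (m + 2)))) := by
    ext x'
    have hiff (T : Finset (Fin (m + 2))) (hT : 0 ∉ T) :=
      sharesFacet_intComb_iff hG hGram (z := indVec X) (z' := indVec T)
        (indVec_injective.ne fun h => hT (h ▸ hX))
    constructor
    · rintro ⟨hx', hS⟩
      obtain ⟨T, hT, rfl⟩ := mem_cornerSet_zero_iff.1 hx'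
      obtain ⟨U, hU, rfl⟩ := (hP T).1 ⟨hT, (hiff T hT).1 hS⟩
      exact ⟨U, hU, rfl⟩
    · rintro ⟨U, hU, rfl⟩
      obtain ⟨hT, hq⟩ := (hP _).2 ⟨U, hU, rfl⟩
      exact ⟨mem_cornerSet_zero_iff.2 ⟨_, hT, rfl⟩, (hiff _ hT).2 hq⟩
  rw [hset, Set.InjOn.ncard_image, Set.ncard_coe_finset]
  intro U hU V hV h
  have h' := indVec_injective (intComb_injective hG h)
  rw [← (hdisj U hU).sup_sdiff_cancel_left, ← (hdisj V hV).sup_sdiff_cancel_left]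
  exact congrArg (· \ S) h'

lemma sum_indVec {n : ℕ} (T : Finset (Fin n)) : ∑ j, indVec T j = T.card := by
  simp [indVec]

lemma sum_indVec_sub {n : ℕ} (T S : Finset (Fin n)) :
    ∑ j, (indVec T j - indVec S j) = ((T \ S).card : ℤ) - (S \ T).card := by
  have (j : Fin n) : indVec T j - indVec S j = indVec (T \ S) j - indVec (S \ T) j := by
    simp only [indVec, Finset.mem_sdiff]
    split_ifs <;> grind
  simp only [this, Finset.sum_sub_distrib, sum_indVec]

lemma sum_indVec_sub_mul_self {n : ℕ} (T S : Finset (Fin n)) :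
    ∑ j, (indVec T j - indVec S j) * (indVec T j - indVec S j) =
      ((T \ S).card : ℤ) + (S \ T).card := by
  have (j : Fin n) : (indVec T j - indVec S j) * (indVec T j - indVec S j) =
      indVec (T \ S) j + indVec (S \ T) j := by
    simp only [indVec, Finset.mem_sdiff]
    split_ifs <;> grind
  simp only [this, Finset.sum_add_distrib, sum_indVec]

lemma formD_self_sub (u v : Fin (m + 2) → ℤ) :
    formD (u - v) (u - v) = formD u u - 2 * formD u v + formD v v := by
  simp only [formD, sub_dotProduct, dotProduct_sub, Pi.sub_apply, Finset.sum_sub_distrib,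
    dotProduct_comm v u]
  ring

lemma formD_indVec_sub_self {S T : Finset (Fin (m + 2))} (hS0 : 0 ∉ S) (hT0 : 0 ∉ T) :
    formD (indVec T - indVec S) (indVec T - indVec S) =
      (((T \ S).card : ℤ) - (S \ T).card) ^ 2 + (T \ S).card + (S \ T).card := by
  simp only [formD, dotProduct, Pi.sub_apply, sum_indVec_sub, sum_indVec_sub_mul_self]
  simp only [indVec, hS0, hT0, if_false]
  ring

lemma indVec_insert {n : ℕ} {S : Finset (Fin n)} {k : Fin n} (hk : k ∉ S) :
    indVec (insert k S) = indVec S + Pi.single k 1 := by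
  ext j
  by_cases h : j = k
  · simp [indVec, h, hk]
  · simp [indVec, h]

lemma formD_indVec_sub_insert_zero {S T : Finset (Fin (m + 2))} (hS0 : 0 ∉ S) (hS1 : 1 ∉ S)
    (hT0 : 0 ∉ T) :
    formD (indVec T - indVec (insert 0 S)) (indVec T - indVec (insert 0 S)) =
      (((T \ S).card : ℤ) - (S \ T).card - 1) ^ 2 + (T \ S).card + (S \ T).card + 1 +
        2 * indVec T 1 := by
  have h1 : formD (indVec T - indVec S) (Pi.single 0 1) =
      ((T \ S).card : ℤ) - (S \ T).card - indVec T 1 := by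
    simp only [formD, Pi.sub_apply, sum_indVec_sub, dotProduct_single, Finset.sum_pi_single']
    simp [indVec, hS0, hT0, hS1]
  have h2 : formD (Pi.single 0 1 : Fin (m + 2) → ℤ) (Pi.single 0 1) = 2 := by
    simp [formD]
  rw [indVec_insert hS0, ← sub_sub, formD_self_sub, formD_indVec_sub_self hS0 hT0, h1, h2]
  ring

lemma formD_indVec_sub_insert_zero_one {S T : Finset (Fin (m + 2))} (hS0 : 0 ∉ S) (hS1 : 1 ∉ S)
    (hT0 : 0 ∉ T) :
    formD (indVec T - indVec (insert 0 (insert 1 S))) (indVec T - indVec (insert 0 (insert 1 S))) =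
      (((T \ S).card : ℤ) - (S \ T).card - 2) ^ 2 + (T \ S).card + (S \ T).card := by
  have h1 : formD (indVec T - indVec S) (Pi.single 1 1 + Pi.single 0 1) =
      2 * (((T \ S).card : ℤ) - (S \ T).card) := by
    simp only [formD, Pi.sub_apply, sum_indVec_sub, dotProduct_add, dotProduct_single,
      Pi.add_apply, Finset.sum_add_distrib, Finset.sum_pi_single']
    simp [indVec, hS0, hT0, hS1]
    ring
  have h2 : formD (Pi.single 1 1 + Pi.single 0 1 : Fin (m + 2) → ℤ)
      (Pi.single 1 1 + Pi.single 0 1) = 4 := by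
    simp [formD, Finset.sum_add_distrib]
  rw [indVec_insert (by simp [hS0]), indVec_insert hS1, add_assoc, ← sub_sub, formD_self_sub,
    formD_indVec_sub_self hS0 hT0, h1, h2]
  ring

lemma intComb_indVec_insert {n : ℕ} (G : Matrix (Fin n) (Fin n) ℝ) {S : Finset (Fin n)}
    {k : Fin n} (hk : k ∉ S) : intComb G (indVec (insert k S)) = intComb G (indVec S) + G k := by
  rw [intComb_indVec, intComb_indVec, add_comm]
  exact Finset.sum_insert hk

end Counting

/-- for the `Dₙ` basis and `S ⊆ {3,…,n}` with `|S| = i` (0-based: `S` avoids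
indices `0` and `1`): the corner `x_S + g₁ ∈ C¹` has `1 + (n−2−i)` facet-neighbors in
`C⁰`, and the corner `x_S + g₂ + g₁ ∈ C¹` has `1 + 2(n−2−i) + C(n−2−i,2)` of them. -/
theorem Dn_neighbor_counts (n : ℕ) [NeZero n] (hn : 3 ≤ n)
    (G : Matrix (Fin n) (Fin n) ℝ) (hG : IsUnit G.det)
    (hGram : G * G.transpose = gramD n)
    (S : Finset (Fin n)) (hS : ∀ j ∈ S, 2 ≤ (j : ℕ)) (i : ℕ) (hSi : S.card = i) :
    let xS : Fin n → ℝ := ∑ j ∈ S, G j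
    Set.ncard {x' : Fin n → ℝ | x' ∈ cornerSet G 0 ∧
        sharesFacet G (xS + G ⟨0, by omega⟩) x'}
      = 1 + (n - 2 - i) ∧
    Set.ncard {x' : Fin n → ℝ | x' ∈ cornerSet G 0 ∧
        sharesFacet G (xS + G ⟨1, by omega⟩ + G ⟨0, by omega⟩) x'}
      = 1 + 2 * (n - 2 - i) + Nat.choose (n - 2 - i) 2 := by
  intro xS
  obtain ⟨m, rfl⟩ : ∃ m, n = m + 2 := ⟨n - 2, by omega⟩
  subst hSi
  have hS0 : (0 : Fin (m + 2)) ∉ S := fun h => by simpa using hS _ h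
  have hS1 : (1 : Fin (m + 2)) ∉ S := fun h => by simpa using hS _ h
  have h01 : (0 : Fin (m + 2)) ∉ insert 1 S := by simp [hS0]
  have hxS : xS = intComb G (indVec S) := (intComb_indVec G S).symm
  have hone : (⟨1, by omega⟩ : Fin (m + 2)) = 1 := by
    rw [Fin.ext_iff, Fin.val_one]
  have hx0 : xS + G ⟨0, by omega⟩ = intComb G (indVec (insert 0 S)) :=
    (congrArg (· + G 0) hxS).trans (intComb_indVec_insert G hS0).symm
  have hx1 : xS + G ⟨1, by omega⟩ + G ⟨0, by omega⟩ =
      intComb G (indVec (insert 0 (insert 1 S))) := by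
    rw [intComb_indVec_insert G h01, intComb_indVec_insert G hS1, ← hxS, hone]
    rfl
  have hcard0 : (insert 0 S)ᶜ.card = m + 1 - S.card := by
    rw [Finset.card_compl, Finset.card_insert_of_notMem hS0, Fintype.card_fin]
    omega
  have hcard1 : (insert 0 (insert 1 S))ᶜ.card = m - S.card := by
    rw [Finset.card_compl, Finset.card_insert_of_notMem h01, Finset.card_insert_of_notMem hS1,
      Fintype.card_fin]
    omega
  have hle : S.card ≤ m := by
    have := Finset.card_le_univ (insert 0 (insert 1 S))
    rw [Finset.card_insert_of_notMem h01, Finset.card_insert_of_notMem hS1,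
      Fintype.card_fin] at this
    omega
  have hpair (R : Finset (Fin (m + 2))) (k : ℕ) :
      (powersetCard k R ∪ powersetCard (k + 1) R).card = (R.card + 1).choose (k + 1) := by
    rw [Finset.card_union_of_disjoint (Finset.pairwise_disjoint_powersetCard R (by simp)),
      Finset.card_powersetCard, Finset.card_powersetCard, Nat.choose_succ_succ]
  have hmem {k : ℕ} {R U : Finset (Fin (m + 2))} :
      U ∈ powersetCard k R ∪ powersetCard (k + 1) R ↔ U ⊆ R ∧ (U.card = k ∨ U.card = k + 1) := by
    simp only [Finset.mem_union, Finset.mem_powersetCard]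
    tauto
  have hdisj0 {U : Finset (Fin (m + 2))} (hU : U ⊆ (insert 0 S)ᶜ) : Disjoint S U :=
    (Finset.subset_compl_iff_disjoint_left.1 hU).mono_left (Finset.subset_insert _ _)
  have hdisj1 {U : Finset (Fin (m + 2))} (hU : U ⊆ (insert 0 (insert 1 S))ᶜ) : Disjoint S U :=
    (Finset.subset_compl_iff_disjoint_left.1 hU).mono_left
      ((Finset.subset_insert _ _).trans (Finset.subset_insert _ _))
  constructor
  · rw [hx0, ncard_facetNeighbors hG hGram (by simp) (S := S)
      (P := powersetCard 0 (insert 0 (insert 1 S))ᶜ ∪ powersetCard 1 (insert 0 (insert 1 S))ᶜ),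
      hpair, hcard1]
    · rw [zero_add, Nat.choose_one_right, add_comm]
      rfl
    · exact fun U hU => hdisj1 (hmem.1 hU).1
    · intro T
      constructor
      · rintro ⟨hT0, hq⟩
        rw [formD_indVec_sub_insert_zero hS0 hS1 hT0] at hq
        have hT1 : 1 ∉ T := by
          intro hT1
          have hpos : 0 < (T \ S).card := Finset.card_pos.2 ⟨1, by simp [hT1, hS1]⟩
          simp only [indVec, hT1, if_true] at hq
          nlinarith
        simp only [indVec, hT1, if_false] at hq
        have hab : (S \ T).card = 0 ∧ ((T \ S).card = 0 ∨ (T \ S).card = 1) := by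
          generalize (S \ T).card = b, (T \ S).card = a at hq
          have ha : a ≤ 1 := by zify; nlinarith
          have hb : b ≤ 1 := by zify; nlinarith
          interval_cases a <;> interval_cases b <;> simp at hq ⊢
        refine ⟨T \ S, hmem.2 ⟨?_, hab.2⟩, Finset.union_sdiff_of_subset
          (Finset.sdiff_eq_empty_iff_subset.1 (Finset.card_eq_zero.1 hab.1))⟩
        intro j hj
        simp only [Finset.mem_sdiff, Finset.mem_compl, Finset.mem_insert] at hj ⊢
        grind
      · rintro ⟨U, hU, rfl⟩
        obtain ⟨hUR, hUc⟩ := hmem.1 hU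
        have hT0 : 0 ∉ S ∪ U := by
          have := @hUR 0
          simp_all
        have hT1 : 1 ∉ S ∪ U := by
          have := @hUR 1
          simp_all
        have hUS := Finset.union_sdiff_cancel_left (hdisj1 hUR)
        refine ⟨hT0, ?_⟩
        rw [formD_indVec_sub_insert_zero hS0 hS1 hT0, hUS,
          Finset.sdiff_eq_empty_iff_subset.2 Finset.subset_union_left]
        simp only [indVec, hT1, if_false]
        rcases hUc with h | h <;> simp [h]
  · rw [hx1, ncard_facetNeighbors hG hGram (by simp) (S := S)
      (P := powersetCard 1 (insert 0 S)ᶜ ∪ powersetCard 2 (insert 0 S)ᶜ),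
      hpair, hcard0]
    · rw [show m + 2 - 2 - S.card = m - S.card from rfl,
        show m + 1 - S.card = m - S.card + 1 by omega]
      rw [Nat.choose_succ_succ', Nat.choose_succ_succ' _ 1, Nat.choose_one_right,
        Nat.choose_one_right]
      simp only [Nat.reduceAdd]
      omega
    · exact fun U hU => hdisj0 (hmem.1 hU).1
    · intro T
      constructor
      · rintro ⟨hT0, hq⟩
        rw [formD_indVec_sub_insert_zero_one hS0 hS1 hT0] at hq
        have hab : (S \ T).card = 0 ∧ ((T \ S).card = 1 ∨ (T \ S).card = 2) := by
          generalize (S \ T).card = b, (T \ S).card = a at hq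
          have ha : a ≤ 2 := by zify; nlinarith
          have hb : b ≤ 2 := by zify; nlinarith
          interval_cases a <;> interval_cases b <;> simp at hq ⊢
        refine ⟨T \ S, hmem.2 ⟨?_, hab.2⟩, Finset.union_sdiff_of_subset
          (Finset.sdiff_eq_empty_iff_subset.1 (Finset.card_eq_zero.1 hab.1))⟩
        intro j hj
        simp only [Finset.mem_sdiff, Finset.mem_compl, Finset.mem_insert] at hj ⊢
        grind
      · rintro ⟨U, hU, rfl⟩
        obtain ⟨hUR, hUc⟩ := hmem.1 hU
        have hT0 : 0 ∉ S ∪ U := by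
          have := @hUR 0
          simp_all
        have hUS := Finset.union_sdiff_cancel_left (hdisj0 hUR)
        refine ⟨hT0, ?_⟩
        rw [formD_indVec_sub_insert_zero_one hS0 hS1 hT0, hUS,
          Finset.sdiff_eq_empty_iff_subset.2 Finset.subset_union_left]
        rcases hUc with h | h <;> simp [h]
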